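/- arXiv:2403.04844 — 6 statements merged into one kernel-verified Lean document; each statement's English description precedes it below -/
import Mathlib

section
/- Let ρ₀ be an n×n density matrix and let H_A, H_B, G, O be Hermitian n×n complex matrices. Define A(t₁,t₂) = i·Tr[exp(-i·t₂·H_B)·ρ₀·exp(i·t₂·H_B)·[G, exp(i·t₁·H_A)·O·exp(-i·t₁·H_A)]], set g = |Tr[ρ₀·[G,O]]|, K = max(‖H_B‖, ‖[H_A,O]‖) and Q = max(‖[G,O]‖, ‖G‖), and assume g > 0 (hence K, Q > 0). Then for all t_A, t_B ≥ 0 with t_A + t_B ≤ g/(4·K·Q), one has |A(t_A, t_B)| ≥ g/2. -/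
open scoped Matrix.Norms.L2Operator ComplexOrder
open Matrix NormedSpace

/-- The exponential of an imaginary multiple of a self-adjoint element is unitary. -/
theorem IsSelfAdjoint.exp_smul_mem_unitary {𝔸 : Type*} [CStarAlgebra 𝔸] {h : 𝔸}
    (hh : IsSelfAdjoint h) {c : ℂ} (hc : star c = -c) : NormedSpace.exp (c • h) ∈ unitary 𝔸 := by
  let +nondep : NormedAlgebra ℚ 𝔸 := .restrictScalars ℚ ℂ 𝔸
  exact exp_mem_unitary_of_mem_skewAdjoint (hh.smul_mem_skewAdjoint hc)

/-- Conjugating `x` by the one-parameter unitary group generated by a self-adjoint `h` moves it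
by at most `t` times the norm of the commutator. -/
theorem norm_exp_conj_sub_le {𝔸 : Type*} [CStarAlgebra 𝔸] {h : 𝔸} (hh : IsSelfAdjoint h) (x : 𝔸)
    {t : ℝ} (ht : 0 ≤ t) :
    ‖exp ((Complex.I * (t : ℂ)) • h) * x * exp ((-Complex.I * (t : ℂ)) • h) - x‖ ≤
      ‖h * x - x * h‖ * t := by
  have hunit (c : ℂ) (hc : star c = -c) (s : ℝ) : exp (s • (c • h)) ∈ unitary 𝔸 := by
    rw [← smul_assoc]
    exact hh.exp_smul_mem_unitary (by simp [hc])
  have hderiv (s : ℝ) : HasDerivAt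
      (fun u : ℝ => exp (u • (Complex.I • h)) * x * exp (u • (-Complex.I • h)))
      (exp (s • (Complex.I • h)) * (Complex.I • (h * x - x * h)) *
        exp (s • (-Complex.I • h))) s := by
    have h₁ := hasDerivAt_exp_smul_const (Complex.I • h) s
    have h₂ := hasDerivAt_exp_smul_const' (-Complex.I • h) s
    refine ((h₁.mul_const x).mul h₂).congr_deriv ?_
    simp only [smul_sub, mul_sub, sub_mul, mul_assoc, smul_mul_assoc, mul_smul_comm, neg_smul,
      neg_mul, mul_neg]
    abel
  have hbound (s : ℝ) : ‖exp (s • (Complex.I • h)) * (Complex.I • (h * x - x * h)) *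
        exp (s • (-Complex.I • h))‖ ≤ ‖h * x - x * h‖ := by
    rw [CStarRing.norm_mul_mem_unitary _ (hunit _ (by simp) s),
      CStarRing.norm_mem_unitary_mul _ (hunit _ (by simp) s), norm_smul]
    simp
  have key := norm_image_sub_le_of_norm_deriv_le_segment'
    (fun s _ => (hderiv s).hasDerivWithinAt) (fun s _ => hbound s) t ⟨ht, le_rfl⟩
  simpa [← Complex.coe_smul, smul_smul, mul_comm] using key

/-- The quadratic form of a matrix at a vector is bounded by the operator norm. -/
theorem Matrix.norm_star_dotProduct_mulVec_le {n : Type*} [Fintype n] [DecidableEq n]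
    (M : Matrix n n ℂ) (v : n → ℂ) :
    ‖star v ⬝ᵥ (M *ᵥ v)‖ ≤ ‖M‖ * ‖WithLp.toLp 2 v‖ ^ 2 := by
  rw [dotProduct_comm, ← EuclideanSpace.inner_toLp_toLp]
  calc _ ≤ ‖WithLp.toLp 2 v‖ * ‖WithLp.toLp 2 (M *ᵥ v)‖ := norm_inner_le_norm _ _
    _ ≤ ‖WithLp.toLp 2 v‖ * (‖M‖ * ‖WithLp.toLp 2 v‖) := by
      gcongr
      exact M.l2_opNorm_mulVec (WithLp.toLp 2 v)
    _ = _ := by ring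

open scoped MatrixOrder in
/-- The expectation of an observable in a state is bounded by its operator norm. -/
theorem Matrix.PosSemidef.norm_trace_mul_le {n : Type*} [Fintype n] [DecidableEq n]
    {ρ : Matrix n n ℂ} (hρ : ρ.PosSemidef) (hρtr : ρ.trace = 1) (M : Matrix n n ℂ) :
    ‖(ρ * M).trace‖ ≤ ‖M‖ := by
  obtain ⟨B, rfl⟩ := CStarAlgebra.nonneg_iff_eq_star_mul_self.mp hρ.nonneg
  rw [star_eq_conjTranspose] at *
  have hsum (N : Matrix n n ℂ) :
      (Bᴴ * B * N).trace = ∑ i, star (star (B i)) ⬝ᵥ (N *ᵥ star (B i)) := by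
    rw [mul_assoc, trace_mul_comm, mul_assoc]
    simp only [trace, diag_apply, mul_apply_eq_vecMul, star_star]
    rfl
  have hone : ∑ i, ‖WithLp.toLp 2 (star (B i))‖ ^ 2 = 1 := by
    have h := hsum 1
    rw [mul_one, hρtr] at h
    apply Complex.ofReal_injective
    rw [Complex.ofReal_one, h, Complex.ofReal_sum]
    refine Finset.sum_congr rfl fun i _ => ?_
    rw [one_mulVec, dotProduct_comm, ← EuclideanSpace.inner_toLp_toLp,
      inner_self_eq_norm_sq_to_K]
    simp
  rw [hsum]
  calc _ ≤ ∑ i, ‖M‖ * ‖WithLp.toLp 2 (star (B i))‖ ^ 2 :=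
        norm_sum_le_of_le _ fun i _ => M.norm_star_dotProduct_mulVec_le _
    _ = ‖M‖ := by rw [← Finset.mul_sum, hone, mul_one]

/-- A commutator is bounded by twice the product of the norms. -/
theorem norm_mul_sub_mul_le {R : Type*} [NormedRing R] (a b : R) :
    ‖a * b - b * a‖ ≤ 2 * (‖a‖ * ‖b‖) := by
  have h₁ := norm_mul_le a b
  have h₂ := norm_mul_le b a
  linarith [norm_sub_le (a * b) (b * a), mul_comm ‖a‖ ‖b‖]

/-- For a density matrix `ρ₀` and Hermitian matrices `H_A, H_B, G, O`, with
`A(t₁,t₂) = i·Tr[exp(-i t₂ H_B) ρ₀ exp(i t₂ H_B) [G, exp(i t₁ H_A) O exp(-i t₁ H_A)]]`,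
`g = |Tr[ρ₀ [G,O]]| > 0`, `K = max(‖H_B‖, ‖[H_A,O]‖)`, `Q = max(‖[G,O]‖, ‖G‖)`,
every `t_A, t_B ≥ 0` with `t_A + t_B ≤ g/(4KQ)` satisfies `|A(t_A,t_B)| ≥ g/2`. -/
theorem stmt_0 {n : ℕ} (ρ₀ H_A H_B G O : Matrix (Fin n) (Fin n) ℂ)
    (hρ : ρ₀.PosSemidef) (hρtr : ρ₀.trace = 1)
    (hHA : H_A.IsHermitian) (hHB : H_B.IsHermitian)
    (hG : G.IsHermitian) (hO : O.IsHermitian)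
    (A : ℝ → ℝ → ℂ)
    (hA : ∀ t₁ t₂ : ℝ, A t₁ t₂ =
      Complex.I * (exp ((-Complex.I * (t₂ : ℂ)) • H_B) * ρ₀ *
        exp ((Complex.I * (t₂ : ℂ)) • H_B) *
        (G * (exp ((Complex.I * (t₁ : ℂ)) • H_A) * O * exp ((-Complex.I * (t₁ : ℂ)) • H_A)) -
         (exp ((Complex.I * (t₁ : ℂ)) • H_A) * O * exp ((-Complex.I * (t₁ : ℂ)) • H_A)) * G)).trace)
    (g K Q : ℝ)
    (hg : g = ‖(ρ₀ * (G * O - O * G)).trace‖)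
    (hK : K = max ‖H_B‖ ‖H_A * O - O * H_A‖)
    (hQ : Q = max ‖G * O - O * G‖ ‖G‖)
    (hgpos : 0 < g) :
    ∀ t_A t_B : ℝ, 0 ≤ t_A → 0 ≤ t_B → t_A + t_B ≤ g / (4 * K * Q) →
      g / 2 ≤ ‖A t_A t_B‖ := by
  intro t_A t_B htA htB ht
  set U := exp ((Complex.I * (t_B : ℂ)) • H_B)
  set V := exp ((-Complex.I * (t_B : ℂ)) • H_B)
  set P := exp ((Complex.I * (t_A : ℂ)) • H_A) * O * exp ((-Complex.I * (t_A : ℂ)) • H_A)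
  set X := G * O - O * G
  have hK0 : 0 ≤ K := hK ▸ le_max_of_le_left (norm_nonneg _)
  have hQ0 : 0 ≤ Q := hQ ▸ le_max_of_le_left (norm_nonneg _)
  have hBK : ‖H_B‖ ≤ K := hK ▸ le_max_left _ _
  have hAK : ‖H_A * O - O * H_A‖ ≤ K := hK ▸ le_max_right _ _
  have hXQ : ‖X‖ ≤ Q := hQ ▸ le_max_left _ _
  have hGQ : ‖G‖ ≤ Q := hQ ▸ le_max_right _ _
  have hbudget : 2 * K * Q * (t_A + t_B) ≤ g / 2 := by
    rcases (mul_nonneg hK0 hQ0).eq_or_lt with h | h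
    · rw [mul_assoc 2, ← h]
      linarith
    · rw [mul_assoc 4, le_div_iff₀ (by positivity)] at ht
      linarith
  have hconjP : ‖P - O‖ ≤ K * t_A :=
    (norm_exp_conj_sub_le hHA O htA).trans (by gcongr)
  have hconjX : ‖U * X * V - X‖ ≤ 2 * (K * Q) * t_B :=
    (norm_exp_conj_sub_le hHB X htB).trans <| by
      gcongr
      exact (norm_mul_sub_mul_le _ _).trans (by gcongr)
  have hconjD : ‖U * (G * (P - O) - (P - O) * G) * V‖ ≤ 2 * (K * Q) * t_A := by
    rw [CStarRing.norm_mul_mem_unitary _ (hHB.isSelfAdjoint.exp_smul_mem_unitary (by simp)),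
      CStarRing.norm_mem_unitary_mul _ (hHB.isSelfAdjoint.exp_smul_mem_unitary (by simp))]
    calc _ ≤ 2 * (‖G‖ * ‖P - O‖) := norm_mul_sub_mul_le _ _
      _ ≤ 2 * (Q * (K * t_A)) := by gcongr
      _ = _ := by ring
  have hsplit : (V * ρ₀ * U * (G * P - P * G)).trace = (ρ₀ * X).trace +
      (ρ₀ * (U * X * V - X + U * (G * (P - O) - (P - O) * G) * V)).trace := by
    rw [← trace_add, ← mul_add, mul_assoc, mul_assoc, trace_mul_comm]
    congr 1
    simp only [X]
    noncomm_ring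
  have herr := (hρ.norm_trace_mul_le hρtr
    (U * X * V - X + U * (G * (P - O) - (P - O) * G) * V)).trans (norm_add_le _ _)
  rw [hA, norm_mul, Complex.norm_I, one_mul, hsplit]
  have htri := norm_le_add_norm_add (ρ₀ * X).trace
    (ρ₀ * (U * X * V - X + U * (G * (P - O) - (P - O) * G) * V)).trace
  rw [← hg] at htri
  linarith
end

section
/- For N qubits, a graph E on the qubit indices, and any angles θ_1, …, θ_N ∈ ℝ, one has the circuit identity CZ_E · ∏_{j=1}^N exp(-i·θ_j·X_j/2) = ∏_{j=1}^N exp(-i·θ_j·Λ_j/2) · CZ_E, where Λ_j = X_j · ∏_{l ∈ N(j)} Z_l. -/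
open Matrix NormedSpace

namespace Qubits

noncomputable section

/-- N-qubit basis states. -/
abbrev QState (N : ℕ) := Fin N → Fin 2

/-- Operators on the N-qubit Hilbert space (dimension `2^N`). -/
abbrev QOp (N : ℕ) := Matrix (QState N) (QState N) ℂ

/-- Pauli X. -/
def pX : Matrix (Fin 2) (Fin 2) ℂ := !![0, 1; 1, 0]

/-- Pauli Y. -/
def pY : Matrix (Fin 2) (Fin 2) ℂ := !![0, -Complex.I; Complex.I, 0]

/-- Pauli Z. -/
def pZ : Matrix (Fin 2) (Fin 2) ℂ := !![1, 0; 0, -1]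

/-- The single-qubit operator `M` acting on qubit `k` and as the identity on all other qubits. -/
def onQubit {N : ℕ} (M : Matrix (Fin 2) (Fin 2) ℂ) (k : Fin N) : QOp N :=
  Matrix.of fun x y => if ∀ j, j ≠ k → x j = y j then M (x k) (y k) else 0

/-- The product `∏_{j ∈ S} f j` of matrices over a finite set of qubit indices, taken in
increasing order of the index (the factors we use always commute pairwise). -/
def prodOver {N : ℕ} (S : Finset (Fin N)) (f : Fin N → QOp N) : QOp N :=
  ((S.sort (· ≤ ·)).map f).prod

/-- The CZ layer of a graph `G` on the qubit indices: the diagonal matrix whose entry at the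
basis state `x` is `(-1)^(Σ_{{j,j'} ∈ E} x_j·x_{j'})`. -/
def czLayer {N : ℕ} (G : SimpleGraph (Fin N)) [DecidableRel G.Adj] : QOp N :=
  Matrix.diagonal fun x =>
    (-1 : ℂ) ^ ∑ e ∈ G.edgeFinset,
      Sym2.lift ⟨fun j j' => (x j : ℕ) * (x j' : ℕ), fun _ _ => Nat.mul_comm _ _⟩ e

end

end Qubits

open Matrix Qubits NormedSpace

namespace Qubits

/-- The edge sum splits into the edges incident to `j` and the others. -/
theorem sum_edgeFinset_eq_add_neighborFinset {N : ℕ} (G : SimpleGraph (Fin N))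
    [DecidableRel G.Adj] (x : QState N) (j : Fin N) :
    ∑ e ∈ G.edgeFinset,
        Sym2.lift ⟨fun k k' => (x k : ℕ) * (x k' : ℕ), fun _ _ => Nat.mul_comm _ _⟩ e =
      (x j : ℕ) * ∑ l ∈ G.neighborFinset j, (x l : ℕ) +
        ∑ e ∈ G.edgeFinset with j ∉ e,
          Sym2.lift ⟨fun k k' => (x k : ℕ) * (x k' : ℕ), fun _ _ => Nat.mul_comm _ _⟩ e := by
  have hinc : G.edgeFinset.filter (fun e => j ∈ e) =
      (G.neighborFinset j).image (fun l => s(j, l)) := by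
    ext e
    simp only [Finset.mem_filter, SimpleGraph.mem_edgeFinset, Finset.mem_image,
      SimpleGraph.mem_neighborFinset]
    constructor
    · rintro ⟨he, l, rfl⟩
      exact ⟨l, he, rfl⟩
    · rintro ⟨l, hl, rfl⟩
      exact ⟨hl, Sym2.mem_mk_left j l⟩
  rw [← Finset.sum_filter_add_sum_filter_not G.edgeFinset (fun e => j ∈ e), hinc,
    Finset.sum_image (fun a _ b _ h => Sym2.congr_right.mp h), Finset.mul_sum]
  simp only [Sym2.lift_mk]

theorem onQubit_pZ {N : ℕ} (l : Fin N) :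
    onQubit pZ l = Matrix.diagonal fun x : QState N => (-1 : ℂ) ^ (x l : ℕ) := by
  ext x y
  rw [onQubit, Matrix.of_apply, Matrix.diagonal_apply]
  by_cases hxy : x = y
  · subst hxy
    have hx : x l = 0 ∨ x l = 1 := by lia
    rcases hx with hx | hx <;> simp [hx, pZ]
  · rw [if_neg hxy]
    split_ifs with h
    · have hl : x l ≠ y l := fun hl => hxy <| funext fun k =>
        if hk : k = l then hk ▸ hl else h k hk
      generalize x l = a at hl
      generalize y l = b at hl
      fin_cases a <;> fin_cases b <;> simp_all [pZ]
    · rfl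

theorem prodOver_onQubit_pZ {N : ℕ} (S : Finset (Fin N)) :
    prodOver S (fun l => onQubit pZ l) =
      Matrix.diagonal fun x : QState N => (-1 : ℂ) ^ ∑ l ∈ S, (x l : ℕ) := by
  have hlist (L : List (Fin N)) : (L.map fun l => onQubit pZ l).prod =
      Matrix.diagonal fun x : QState N => (-1 : ℂ) ^ (L.map fun l => (x l : ℕ)).sum := by
    induction L with
    | nil => simp
    | cons a L ih =>
      rw [List.map_cons, List.prod_cons, ih, onQubit_pZ, Matrix.diagonal_mul_diagonal]
      simp only [List.map_cons, List.sum_cons, pow_add]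
  rw [prodOver, hlist]
  congr! 3 with x
  rw [← List.sum_toFinset _ (S.sort_nodup _), Finset.sort_toFinset]

theorem czLayer_mul_self {N : ℕ} (G : SimpleGraph (Fin N)) [DecidableRel G.Adj] :
    czLayer G * czLayer G = 1 := by
  rw [czLayer, Matrix.diagonal_mul_diagonal, ← Matrix.diagonal_one]
  congr! 2 with x
  rw [← mul_pow]
  simp

/-- The CZ layer conjugates `X_j` to the graph-state stabilizer generator at `j`. -/
theorem semiconjBy_czLayer_onQubit_pX {N : ℕ} (G : SimpleGraph (Fin N)) [DecidableRel G.Adj]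
    (j : Fin N) :
    SemiconjBy (czLayer G) (onQubit pX j)
      (onQubit pX j * prodOver (G.neighborFinset j) (fun l => onQubit pZ l)) := by
  rw [SemiconjBy, prodOver_onQubit_pZ, czLayer, mul_assoc, Matrix.diagonal_mul_diagonal]
  ext x y
  rw [Matrix.diagonal_mul, Matrix.mul_diagonal, onQubit, Matrix.of_apply]
  split_ifs with h
  · have hnbr : ∑ l ∈ G.neighborFinset j, (x l : ℕ) = ∑ l ∈ G.neighborFinset j, (y l : ℕ) :=
      Finset.sum_congr rfl fun l hl => by
        rw [h l (G.ne_of_adj ((G.mem_neighborFinset j l).mp hl)).symm]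
    have hrest : ∑ e ∈ G.edgeFinset with j ∉ e,
          Sym2.lift ⟨fun k k' => (x k : ℕ) * (x k' : ℕ), fun _ _ => Nat.mul_comm _ _⟩ e =
        ∑ e ∈ G.edgeFinset with j ∉ e,
          Sym2.lift ⟨fun k k' => (y k : ℕ) * (y k' : ℕ), fun _ _ => Nat.mul_comm _ _⟩ e := by
      refine Finset.sum_congr rfl fun e he => ?_
      have hj := (Finset.mem_filter.mp he).2
      induction e with
      | _ a b =>
        rw [Sym2.mem_iff, not_or] at hj
        simp only [Sym2.lift_mk]
        rw [h a (Ne.symm hj.1), h b (Ne.symm hj.2)]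
    rw [sum_edgeFinset_eq_add_neighborFinset G x j, sum_edgeFinset_eq_add_neighborFinset G y j,
      hnbr, hrest]
    generalize ∑ l ∈ G.neighborFinset j, (y l : ℕ) = s
    generalize x j = a
    generalize y j = b
    have hs : (-1 : ℂ) ^ s * (-1) ^ s = 1 := by rw [← mul_pow]; simp
    fin_cases a <;> fin_cases b <;> simp [pX, pow_add, ← mul_assoc, hs]
  · simp

theorem semiconjBy_exp_smul {n : Type*} [Fintype n] [DecidableEq n] {U A B : Matrix n n ℂ}
    (hU : IsUnit U) (h : SemiconjBy U A B) (c : ℂ) :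
    SemiconjBy U (exp (c • A)) (exp (c • B)) := by
  obtain ⟨u, rfl⟩ := hU
  have hB : c • B = u * (c • A) * (u⁻¹ : (Matrix n n ℂ)ˣ) := by
    rw [Units.eq_mul_inv_iff_mul_eq, Matrix.smul_mul, Matrix.mul_smul, h.eq]
  rw [hB, Matrix.exp_units_conj, SemiconjBy, Units.inv_mul_cancel_right]

theorem semiconjBy_prodOver {N : ℕ} {U : QOp N} (S : Finset (Fin N)) {f g : Fin N → QOp N}
    (h : ∀ j, SemiconjBy U (f j) (g j)) : SemiconjBy U (prodOver S f) (prodOver S g) := by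
  unfold prodOver
  induction S.sort (· ≤ ·) with
  | nil => exact SemiconjBy.one_right U
  | cons a L ih => simpa only [List.map_cons, List.prod_cons] using (h a).mul_right ih

end Qubits

/-- For N qubits, a graph E, and angles θ : Fin N → ℝ:
CZ_E · ∏_j exp(-i·θ_j·X_j/2) = ∏_j exp(-i·θ_j·Λ_j/2) · CZ_E,
where Λ_j = X_j · ∏_{l ∈ N(j)} Z_l. -/
theorem stmt_9 {N : ℕ} (G : SimpleGraph (Fin N)) [DecidableRel G.Adj] (θ : Fin N → ℝ) :
    czLayer G * prodOver Finset.univ (fun j => exp ((-Complex.I * (θ j : ℂ) / 2) • onQubit pX j)) =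
      prodOver Finset.univ (fun j => exp ((-Complex.I * (θ j : ℂ) / 2) •
          (onQubit pX j * prodOver (G.neighborFinset j) (fun l => onQubit pZ l)))) *
        czLayer G := by
  exact semiconjBy_prodOver Finset.univ fun j =>
    semiconjBy_exp_smul (IsUnit.of_mul_eq_one _ (czLayer_mul_self G))
      (semiconjBy_czLayer_onQubit_pX G j) _
end

section
/- For N qubits and a graph E on the qubit indices, define the hardware-efficient-ansatz block V(α, β) = CZ_E · ∏_{j=1}^N exp(-i·β_j·Z_j/2) · ∏_{j=1}^N exp(-i·α_j·X_j/2) for angle vectors α, β ∈ ℝ^N. Then for any angle vectors α¹, β¹, α², β² ∈ ℝ^N, the two-block product satisfies V(α², β²) · V(α¹, β¹) = ∏_{j=1}^N exp(-i·β²_j·Z_j/2) · ∏_{j=1}^N exp(-i·α²_j·Λ_j/2) · ∏_{j=1}^N exp(-i·β¹_j·Z_j/2) · ∏_{j=1}^N exp(-i·α¹_j·X_j/2), where Λ_j = X_j · ∏_{l ∈ N(j)} Z_l; in particular the product of two blocks contains no CZ layer. -/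
open Matrix NormedSpace

open Matrix Qubits NormedSpace

namespace Stmt10

/-- The hardware-efficient-ansatz block
V(α,β) = CZ_E · ∏_j exp(-i·β_j·Z_j/2) · ∏_j exp(-i·α_j·X_j/2). -/
noncomputable def heaBlock {N : ℕ} (G : SimpleGraph (Fin N)) [DecidableRel G.Adj]
    (α β : Fin N → ℝ) : QOp N :=
  czLayer G *
    prodOver Finset.univ (fun j => exp ((-Complex.I * (β j : ℂ) / 2) • onQubit pZ j)) *
    prodOver Finset.univ (fun j => exp ((-Complex.I * (α j : ℂ) / 2) • onQubit pX j))

theorem prodOver_semiconjBy {N : ℕ} {U : QOp N} (S : Finset (Fin N)) {f g : Fin N → QOp N}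
    (h : ∀ j, SemiconjBy U (f j) (g j)) : SemiconjBy U (prodOver S f) (prodOver S g) := by
  unfold prodOver
  induction S.sort (· ≤ ·) with
  | nil => exact SemiconjBy.one_right U
  | cons a l ih => simpa using (h a).mul_right ih

theorem exp_smul_semiconjBy {n : Type*} [Fintype n] [DecidableEq n] {U A B : Matrix n n ℂ}
    (hU : U * U = 1) (h : SemiconjBy U A B) (c : ℂ) :
    SemiconjBy U (exp (c • A)) (exp (c • B)) := by
  have hB : U * (c • A) * U = c • B := by
    rw [mul_smul_comm, h.eq, smul_mul_assoc, mul_assoc, hU, mul_one]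
  have hexp : exp (U * (c • A) * U) = U * exp (c • A) * U :=
    Matrix.exp_units_conj (⟨U, U, hU, hU⟩ : (Matrix n n ℂ)ˣ) (c • A)
  rw [SemiconjBy, ← hB, hexp, mul_assoc _ U U, hU, mul_one]

theorem czLayer_eq_diagonal_prod {N : ℕ} (G : SimpleGraph (Fin N)) [DecidableRel G.Adj] :
    czLayer G = diagonal fun x => ∏ e ∈ G.edgeFinset, (-1 : ℂ) ^
      Sym2.lift ⟨fun j j' => (x j : ℕ) * (x j' : ℕ), fun _ _ => Nat.mul_comm _ _⟩ e := by
  simp only [czLayer, Finset.prod_pow_eq_pow_sum]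

theorem czLayer_mul_self {N : ℕ} (G : SimpleGraph (Fin N)) [DecidableRel G.Adj] :
    czLayer G * czLayer G = 1 := by
  simp [czLayer, diagonal_mul_diagonal, ← mul_pow]

theorem onQubit_pZ {N : ℕ} (k : Fin N) :
    onQubit pZ k = diagonal fun x => (-1 : ℂ) ^ (x k : ℕ) := by
  ext x y
  by_cases hxy : x = y
  · subst hxy
    generalize hb : x k = b
    fin_cases b <;> simp [onQubit, pZ, hb]
  · rw [diagonal_apply_ne _ hxy]
    simp only [onQubit, of_apply, ite_eq_right_iff]
    intro h
    have hk : x k ≠ y k := fun hk => hxy <| funext fun j => by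
      by_cases hj : j = k
      · exact hj ▸ hk
      · exact h j hj
    revert hk
    generalize x k = a
    generalize y k = b
    fin_cases a <;> fin_cases b <;> simp [pZ]

theorem prodOver_diagonal {N : ℕ} (S : Finset (Fin N)) (d : Fin N → QState N → ℂ) :
    prodOver S (fun l => diagonal (d l)) = diagonal fun x => ∏ l ∈ S, d l x := by
  have hlist (L : List (Fin N)) : (L.map fun l => (diagonal (d l) : QOp N)).prod =
      diagonal fun x => (L.map fun l => d l x).prod := by
    induction L with
    | nil => simp
    | cons a L ih => simp [ih, diagonal_mul_diagonal]
  rw [prodOver, hlist]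
  congr 1
  funext x
  rw [← List.prod_toFinset _ (S.sort_nodup _), Finset.sort_toFinset]

/-- Flipping qubit `k` changes the CZ phase by `∏_{l ∈ N(k)} (-1)^(y_l)`. -/
theorem prod_edgeFinset_flip {N : ℕ} (G : SimpleGraph (Fin N)) [DecidableRel G.Adj]
    {k : Fin N} {x y : QState N} (hxy : ∀ j, j ≠ k → x j = y j) (hk : x k ≠ y k) :
    (∏ e ∈ G.edgeFinset, (-1 : ℂ) ^
      Sym2.lift ⟨fun j j' => (x j : ℕ) * (x j' : ℕ), fun _ _ => Nat.mul_comm _ _⟩ e) =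
    (∏ l ∈ G.neighborFinset k, (-1 : ℂ) ^ (y l : ℕ)) *
    ∏ e ∈ G.edgeFinset, (-1 : ℂ) ^
      Sym2.lift ⟨fun j j' => (y j : ℕ) * (y j' : ℕ), fun _ _ => Nat.mul_comm _ _⟩ e := by
  have himage : {e ∈ G.edgeFinset | k ∈ e} = (G.neighborFinset k).image (fun l => s(k, l)) := by
    ext e
    induction e with
    | _ a b =>
      simp only [Finset.mem_filter, SimpleGraph.mem_edgeFinset, SimpleGraph.mem_edgeSet,
        Sym2.mem_iff, Finset.mem_image, SimpleGraph.mem_neighborFinset, Sym2.eq_iff]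
      grind [G.adj_comm]
  have hinj : Set.InjOn (fun l => s(k, l)) (G.neighborFinset k) :=
    fun _ _ _ _ h => Sym2.congr_right.1 h
  rw [← Finset.prod_filter_mul_prod_filter_not G.edgeFinset (fun e => k ∈ e),
    ← Finset.prod_filter_mul_prod_filter_not G.edgeFinset (fun e => k ∈ e), ← mul_assoc]
  congr 1
  · rw [himage, Finset.prod_image hinj, Finset.prod_image hinj,
      ← Finset.prod_mul_distrib]
    refine Finset.prod_congr rfl fun l hl => ?_
    have hlk : l ≠ k := ((G.mem_neighborFinset k l).1 hl).ne'
    simp only [Sym2.lift_mk, hxy l hlk]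
    revert hk
    generalize x k = a
    generalize y k = b
    generalize y l = c
    fin_cases a <;> fin_cases b <;> fin_cases c <;> simp
  · refine Finset.prod_congr rfl fun e he => ?_
    induction e with
    | _ a b =>
      simp only [Finset.mem_filter, Sym2.mem_iff, not_or] at he
      simp only [Sym2.lift_mk, hxy a (Ne.symm he.2.1), hxy b (Ne.symm he.2.2)]

theorem czLayer_semiconjBy_pZ {N : ℕ} (G : SimpleGraph (Fin N)) [DecidableRel G.Adj]
    (k : Fin N) : SemiconjBy (czLayer G) (onQubit pZ k) (onQubit pZ k) := by
  rw [onQubit_pZ]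
  exact commute_diagonal _ _

theorem czLayer_semiconjBy_pX {N : ℕ} (G : SimpleGraph (Fin N)) [DecidableRel G.Adj]
    (k : Fin N) : SemiconjBy (czLayer G) (onQubit pX k)
      (onQubit pX k * prodOver (G.neighborFinset k) (fun l => onQubit pZ l)) := by
  simp only [onQubit_pZ, prodOver_diagonal, czLayer_eq_diagonal_prod, SemiconjBy, mul_assoc,
    diagonal_mul_diagonal]
  ext x y
  rw [diagonal_mul, mul_diagonal]
  by_cases h : ∀ j, j ≠ k → x j = y j
  · by_cases hk : x k = y k
    · have hzero : onQubit pX k x y = 0 := by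
        simp only [onQubit, of_apply, if_pos h, hk]
        generalize y k = b
        fin_cases b <;> simp [pX]
      simp [hzero]
    · rw [prod_edgeFinset_flip G h hk, mul_comm]
  · simp [onQubit, if_neg h]

/-- The product of two HEA blocks contains no CZ layer:
V(α²,β²)·V(α¹,β¹) = ∏_j exp(-i·β²_j·Z_j/2) · ∏_j exp(-i·α²_j·Λ_j/2)
· ∏_j exp(-i·β¹_j·Z_j/2) · ∏_j exp(-i·α¹_j·X_j/2), with Λ_j = X_j·∏_{l∈N(j)} Z_l. -/
theorem stmt_10 {N : ℕ} (G : SimpleGraph (Fin N)) [DecidableRel G.Adj]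
    (α₁ β₁ α₂ β₂ : Fin N → ℝ) :
    heaBlock G α₂ β₂ * heaBlock G α₁ β₁ =
      prodOver Finset.univ (fun j => exp ((-Complex.I * (β₂ j : ℂ) / 2) • onQubit pZ j)) *
      prodOver Finset.univ (fun j => exp ((-Complex.I * (α₂ j : ℂ) / 2) •
        (onQubit pX j * prodOver (G.neighborFinset j) (fun l => onQubit pZ l)))) *
      prodOver Finset.univ (fun j => exp ((-Complex.I * (β₁ j : ℂ) / 2) • onQubit pZ j)) *
      prodOver Finset.univ (fun j => exp ((-Complex.I * (α₁ j : ℂ) / 2) • onQubit pX j)) := by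
  have hZ := prodOver_semiconjBy Finset.univ fun j => exp_smul_semiconjBy (czLayer_mul_self G)
    (czLayer_semiconjBy_pZ G j) (-Complex.I * (β₂ j : ℂ) / 2)
  have hX := prodOver_semiconjBy Finset.univ fun j => exp_smul_semiconjBy (czLayer_mul_self G)
    (czLayer_semiconjBy_pX G j) (-Complex.I * (α₂ j : ℂ) / 2)
  simp only [heaBlock]
  rw [hZ.eq, mul_assoc _ (czLayer G), hX.eq]
  simp only [mul_assoc]
  rw [← mul_assoc (czLayer G) (czLayer G), czLayer_mul_self, one_mul]

end Stmt10
end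

section
/- For N qubits and a graph E on the qubit indices, let ϑ ∈ ℝ, φ ∈ ℝ^N, and define the hardware-efficient-ansatz block V = CZ_E · ∏_{j=1}^N exp(-i·φ_j·Z_j/2) · ∏_{j=1}^N exp(-i·ϑ·X_j/2). Then V† · Y_1 · V = (cos(φ_1)·(cos(ϑ)·Y_1 − sin(ϑ)·Z_1) + sin(φ_1)·X_1) · ∏_{j ∈ N(1)} (cos(ϑ)·Z_j + sin(ϑ)·Y_j), where N(1) is the set of neighbors of qubit 1 in E. -/
open Matrix NormedSpace

open Matrix Qubits NormedSpace

namespace Qubits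

noncomputable section

/-- The tensor product `⨂ j, m j` of single-qubit operators. -/
def tensorOp {N : ℕ} (m : Fin N → Matrix (Fin 2) (Fin 2) ℂ) : QOp N :=
  Matrix.of fun x y => ∏ j, m j (x j) (y j)

theorem tensorOp_mul {N : ℕ} (m m' : Fin N → Matrix (Fin 2) (Fin 2) ℂ) :
    tensorOp m * tensorOp m' = tensorOp (fun j => m j * m' j) := by
  ext x y
  simp only [tensorOp, Matrix.mul_apply, Matrix.of_apply, ← Finset.prod_mul_distrib]
  rw [Finset.prod_univ_sum, Fintype.piFinset_univ]

theorem tensorOp_conjTranspose {N : ℕ} (m : Fin N → Matrix (Fin 2) (Fin 2) ℂ) :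
    (tensorOp m)ᴴ = tensorOp (fun j => (m j)ᴴ) := by
  ext x y
  simp [tensorOp, Matrix.conjTranspose_apply]

theorem onQubit_eq_tensorOp {N : ℕ} (M : Matrix (Fin 2) (Fin 2) ℂ) (k : Fin N) :
    onQubit M k = tensorOp (fun j => if j = k then M else 1) := by
  ext x y
  simp only [onQubit, tensorOp, Matrix.of_apply]
  rw [← Finset.mul_prod_erase _ _ (Finset.mem_univ k), if_pos rfl]
  split_ifs with h
  · rw [Finset.prod_eq_one, mul_one]
    intro j hj
    have hjk := Finset.ne_of_mem_erase hj
    rw [if_neg hjk, h j hjk, Matrix.one_apply_eq]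
  · push Not at h
    obtain ⟨j, hjk, hxy⟩ := h
    rw [Finset.prod_eq_zero (Finset.mem_erase.2 ⟨hjk, Finset.mem_univ j⟩), mul_zero]
    rw [if_neg hjk, Matrix.one_apply_ne hxy]

theorem tensorOp_one {N : ℕ} : tensorOp (fun _ : Fin N => (1 : Matrix (Fin 2) (Fin 2) ℂ)) = 1 := by
  ext x y
  by_cases h : x = y
  · rw [h, Matrix.one_apply_eq, tensorOp, Matrix.of_apply]
    refine Finset.prod_eq_one fun j _ => ?_
    exact Matrix.one_apply_eq (y j)
  · obtain ⟨j, hj⟩ := Function.ne_iff.1 h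
    rw [Matrix.one_apply_ne h]
    exact Finset.prod_eq_zero (Finset.mem_univ j) (Matrix.one_apply_ne hj)

theorem list_prod_onQubit {N : ℕ} (m : Fin N → Matrix (Fin 2) (Fin 2) ℂ) (l : List (Fin N))
    (hl : l.Nodup) :
    (l.map fun j => onQubit (m j) j).prod = tensorOp (fun j => if j ∈ l then m j else 1) := by
  induction l with
  | nil => simp [tensorOp_one]
  | cons a l ih =>
    obtain ⟨ha, hl⟩ := List.nodup_cons.1 hl
    rw [List.map_cons, List.prod_cons, ih hl, onQubit_eq_tensorOp, tensorOp_mul]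
    congr 1
    funext j
    by_cases hj : j = a
    · subst hj
      simp [ha]
    · simp [hj]

theorem prodOver_onQubit {N : ℕ} (m : Fin N → Matrix (Fin 2) (Fin 2) ℂ) (S : Finset (Fin N)) :
    prodOver S (fun j => onQubit (m j) j) = tensorOp (fun j => if j ∈ S then m j else 1) := by
  simp [prodOver, list_prod_onQubit m _ (S.sort_nodup (· ≤ ·))]

theorem onQubit_add {N : ℕ} (A B : Matrix (Fin 2) (Fin 2) ℂ) (k : Fin N) :
    onQubit (A + B) k = onQubit A k + onQubit B k := by
  ext x y
  simp only [onQubit, Matrix.of_apply, Matrix.add_apply]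
  split_ifs <;> simp

theorem onQubit_sub {N : ℕ} (A B : Matrix (Fin 2) (Fin 2) ℂ) (k : Fin N) :
    onQubit (A - B) k = onQubit A k - onQubit B k := by
  ext x y
  simp only [onQubit, Matrix.of_apply, Matrix.sub_apply]
  split_ifs <;> simp

theorem onQubit_smul {N : ℕ} (c : ℂ) (A : Matrix (Fin 2) (Fin 2) ℂ) (k : Fin N) :
    onQubit (c • A) k = c • onQubit A k := by
  ext x y
  simp [onQubit]

theorem onQubit_one {N : ℕ} (k : Fin N) : onQubit 1 k = 1 := by
  simp [onQubit_eq_tensorOp, tensorOp_one]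

theorem onQubit_mul {N : ℕ} (A B : Matrix (Fin 2) (Fin 2) ℂ) (k : Fin N) :
    onQubit A k * onQubit B k = onQubit (A * B) k := by
  rw [onQubit_eq_tensorOp, onQubit_eq_tensorOp, onQubit_eq_tensorOp, tensorOp_mul]
  congr 1
  funext j
  split_ifs <;> simp

theorem exp_smul_of_mul_self_eq_one {n : Type*} [Fintype n] [DecidableEq n]
    (P : Matrix n n ℂ) (hP : P * P = 1) (c : ℂ) :
    exp (c • P) = Complex.cosh c • (1 : Matrix n n ℂ) + Complex.sinh c • P := by
  have hev (k : ℕ) : P ^ (2 * k) = 1 := by rw [pow_mul, pow_two, hP, one_pow]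
  rw [exp_eq_tsum ℂ]
  refine (HasSum.even_add_odd ?_ ?_).tsum_eq
  · simpa only [smul_pow, hev, smul_smul, div_eq_inv_mul] using
      (Complex.hasSum_cosh c).smul_const (1 : Matrix n n ℂ)
  · simpa only [smul_pow, pow_succ P, hev, one_mul, smul_smul, div_eq_inv_mul] using
      (Complex.hasSum_sinh c).smul_const P

/-- The rotation `exp(-i·θ·P/2)` generated by an involution `P`. -/
def rot (P : Matrix (Fin 2) (Fin 2) ℂ) (θ : ℝ) : Matrix (Fin 2) (Fin 2) ℂ :=
  (Real.cos (θ / 2) : ℂ) • (1 : Matrix (Fin 2) (Fin 2) ℂ) +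
    (-Complex.I * (Real.sin (θ / 2) : ℂ)) • P

theorem exp_onQubit {N : ℕ} (P : Matrix (Fin 2) (Fin 2) ℂ) (hP : P * P = 1) (θ : ℝ)
    (k : Fin N) :
    exp ((-Complex.I * (θ : ℂ) / 2) • onQubit P k) = onQubit (rot P θ) k := by
  rw [exp_smul_of_mul_self_eq_one _ (by rw [onQubit_mul, hP, onQubit_one]), rot, onQubit_add,
    onQubit_smul, onQubit_smul, onQubit_one]
  have h : -Complex.I * (θ : ℂ) / 2 = -((θ / 2 : ℂ) * Complex.I) := by ring
  rw [h, Complex.cosh_neg, Complex.sinh_neg, Complex.cosh_mul_I, Complex.sinh_mul_I]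
  push_cast
  congr 2
  ring

theorem pX_mul_self : pX * pX = 1 := by
  ext i j
  fin_cases i <;> fin_cases j <;> simp [pX]

theorem pZ_mul_self : pZ * pZ = 1 := by
  ext i j
  fin_cases i <;> fin_cases j <;> simp [pZ]

theorem pX_isHermitian : pX.IsHermitian := by
  ext i j
  fin_cases i <;> fin_cases j <;> simp [pX]

theorem pZ_isHermitian : pZ.IsHermitian := by
  ext i j
  fin_cases i <;> fin_cases j <;> simp [pZ]

theorem rot_conjTranspose {P : Matrix (Fin 2) (Fin 2) ℂ} (hP : P.IsHermitian) (θ : ℝ) :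
    (rot P θ)ᴴ = (Real.cos (θ / 2) : ℂ) • (1 : Matrix (Fin 2) (Fin 2) ℂ) +
      (Complex.I * (Real.sin (θ / 2) : ℂ)) • P := by
  simp [rot, hP.eq, -Complex.ofReal_cos, -Complex.ofReal_sin]

/-- Conjugation by a rotation fixes operators that commute with its generator. -/
theorem rot_conj_of_commute {P M : Matrix (Fin 2) (Fin 2) ℂ} (hP : P.IsHermitian)
    (hPP : P * P = 1) (hM : P * M = M * P) (θ : ℝ) :
    (rot P θ)ᴴ * M * rot P θ = M := by
  have hPM : P * M * P = M := by rw [hM, mul_assoc, hPP, mul_one]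
  have h : (Real.sin (θ / 2) : ℂ) ^ 2 + (Real.cos (θ / 2) : ℂ) ^ 2 = 1 := by
    exact_mod_cast Real.sin_sq_add_cos_sq (θ / 2)
  rw [rot_conjTranspose hP, rot]
  generalize (Real.sin (θ / 2) : ℂ) = s at *
  generalize (Real.cos (θ / 2) : ℂ) = c at *
  simp only [add_mul, mul_add, smul_mul_assoc, mul_smul_comm, one_mul, mul_one, hPM]
  rw [hM]
  match_scalars
  · linear_combination h - s ^ 2 * Complex.I_sq
  · ring

/-- Conjugation by a rotation turns operators that anticommute with its generator. -/
theorem rot_conj_of_anticommute {P M : Matrix (Fin 2) (Fin 2) ℂ} (hP : P.IsHermitian)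
    (hPP : P * P = 1) (hM : P * M = -(M * P)) (θ : ℝ) :
    (rot P θ)ᴴ * M * rot P θ =
      (Real.cos θ : ℂ) • M + (-Complex.I * (Real.sin θ : ℂ)) • (M * P) := by
  have hPM : P * M * P = -M := by rw [hM, neg_mul, mul_assoc, hPP, mul_one]
  have h : (Real.sin (θ / 2) : ℂ) ^ 2 + (Real.cos (θ / 2) : ℂ) ^ 2 = 1 := by
    exact_mod_cast Real.sin_sq_add_cos_sq (θ / 2)
  have hcos : (Real.cos θ : ℂ) = 2 * (Real.cos (θ / 2) : ℂ) ^ 2 - 1 := by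
    exact_mod_cast (by rw [← Real.cos_two_mul, mul_div_cancel₀ θ two_ne_zero] :
      Real.cos θ = 2 * Real.cos (θ / 2) ^ 2 - 1)
  have hsin : (Real.sin θ : ℂ) = 2 * (Real.sin (θ / 2) : ℂ) * (Real.cos (θ / 2) : ℂ) := by
    exact_mod_cast (by rw [← Real.sin_two_mul, mul_div_cancel₀ θ two_ne_zero] :
      Real.sin θ = 2 * Real.sin (θ / 2) * Real.cos (θ / 2))
  rw [rot_conjTranspose hP, rot, hcos, hsin]
  generalize (Real.sin (θ / 2) : ℂ) = s at *
  generalize (Real.cos (θ / 2) : ℂ) = c at *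
  simp only [add_mul, mul_add, smul_mul_assoc, mul_smul_comm, one_mul, mul_one, hPM]
  rw [hM]
  match_scalars
  · linear_combination s ^ 2 * Complex.I_sq - h
  · ring

theorem rotZ_conj_pY (θ : ℝ) :
    (rot pZ θ)ᴴ * pY * rot pZ θ = (Real.cos θ : ℂ) • pY + (Real.sin θ : ℂ) • pX := by
  have hanti : pZ * pY = -(pY * pZ) := by
    ext i j
    fin_cases i <;> fin_cases j <;> simp [pZ, pY]
  have hmul : pY * pZ = Complex.I • pX := by
    ext i j
    fin_cases i <;> fin_cases j <;> simp [pX, pZ, pY]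
  rw [rot_conj_of_anticommute pZ_isHermitian pZ_mul_self hanti, hmul, smul_smul]
  congr 2
  linear_combination -(Real.sin θ : ℂ) * Complex.I_sq

theorem rotX_conj_pY (θ : ℝ) :
    (rot pX θ)ᴴ * pY * rot pX θ = (Real.cos θ : ℂ) • pY - (Real.sin θ : ℂ) • pZ := by
  have hanti : pX * pY = -(pY * pX) := by
    ext i j
    fin_cases i <;> fin_cases j <;> simp [pX, pY]
  have hmul : pY * pX = -Complex.I • pZ := by
    ext i j
    fin_cases i <;> fin_cases j <;> simp [pX, pZ, pY]
  rw [rot_conj_of_anticommute pX_isHermitian pX_mul_self hanti, hmul, smul_smul, sub_eq_add_neg,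
    ← neg_smul]
  congr 2
  linear_combination (Real.sin θ : ℂ) * Complex.I_sq

theorem rotX_conj_pZ (θ : ℝ) :
    (rot pX θ)ᴴ * pZ * rot pX θ = (Real.cos θ : ℂ) • pZ + (Real.sin θ : ℂ) • pY := by
  have hanti : pX * pZ = -(pZ * pX) := by
    ext i j
    fin_cases i <;> fin_cases j <;> simp [pX, pZ]
  have hmul : pZ * pX = Complex.I • pY := by
    ext i j
    fin_cases i <;> fin_cases j <;> simp [pX, pZ, pY]
  rw [rot_conj_of_anticommute pX_isHermitian pX_mul_self hanti, hmul, smul_smul]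
  congr 2
  linear_combination -(Real.sin θ : ℂ) * Complex.I_sq

/-- The exponent of the CZ layer, split into the edges incident to `k` and those avoiding `k`. -/
theorem sum_edges_eq {N : ℕ} (G : SimpleGraph (Fin N)) [DecidableRel G.Adj] (k : Fin N)
    (x : QState N) :
    (∑ e ∈ G.edgeFinset,
      Sym2.lift ⟨fun j j' => (x j : ℕ) * (x j' : ℕ), fun _ _ => Nat.mul_comm _ _⟩ e) =
    (x k : ℕ) * (∑ j ∈ G.neighborFinset k, (x j : ℕ)) +
      ∑ e ∈ G.edgeFinset with k ∉ e,
        Sym2.lift ⟨fun j j' => (x j : ℕ) * (x j' : ℕ), fun _ _ => Nat.mul_comm _ _⟩ e := by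
  rw [← Finset.sum_filter_add_sum_filter_not G.edgeFinset (fun e => k ∈ e)]
  congr 1
  have himage : {e ∈ G.edgeFinset | k ∈ e} = (G.neighborFinset k).image (fun j => s(k, j)) := by
    ext e
    induction e with
    | h a b =>
      simp only [Finset.mem_filter, SimpleGraph.mem_edgeFinset, SimpleGraph.mem_edgeSet,
        Sym2.mem_iff, Finset.mem_image, SimpleGraph.mem_neighborFinset, Sym2.eq_iff]
      constructor
      · rintro ⟨h, rfl | rfl⟩
        · exact ⟨b, h, Or.inl ⟨rfl, rfl⟩⟩
        · exact ⟨a, h.symm, Or.inr ⟨rfl, rfl⟩⟩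
      · rintro ⟨j, h, ⟨rfl, rfl⟩ | ⟨rfl, rfl⟩⟩
        · exact ⟨h, Or.inl rfl⟩
        · exact ⟨h.symm, Or.inr rfl⟩
  rw [himage, Finset.sum_image (fun a _ b _ h => Sym2.congr_right.1 h), Finset.mul_sum]
  rfl

theorem pZ_apply_self (a : Fin 2) : pZ a a = (-1 : ℂ) ^ (a : ℕ) := by
  fin_cases a <;> simp [pZ]

/-- Conjugating `Y_k` by the CZ layer attaches a `Z` to every neighbour of `k`. -/
theorem czLayer_conj_pY {N : ℕ} (G : SimpleGraph (Fin N)) [DecidableRel G.Adj] (k : Fin N) :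
    (czLayer G)ᴴ * onQubit pY k * czLayer G =
      tensorOp (fun j => if j = k then pY else if j ∈ G.neighborFinset k then pZ else 1) := by
  ext x y
  rw [czLayer, Matrix.diagonal_conjTranspose, Matrix.mul_diagonal, Matrix.diagonal_mul]
  simp only [onQubit, tensorOp, Matrix.of_apply, Pi.star_apply, star_pow, star_neg, star_one]
  rw [← Finset.mul_prod_erase _ _ (Finset.mem_univ k), if_pos rfl]
  split_ifs with h
  · by_cases hk : x k = y k
    · have h0 : pY (x k) (y k) = 0 := by
        rw [hk]
        generalize y k = a
        fin_cases a <;> simp [pY]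
      simp [h0]
    · have hsum : ((x k : ℕ) + (y k : ℕ)) = 1 := by omega
      have hnbr : ∑ j ∈ G.neighborFinset k, (y j : ℕ) = ∑ j ∈ G.neighborFinset k, (x j : ℕ) := by
        refine Finset.sum_congr rfl fun j hj => ?_
        rw [h j (G.ne_of_adj ((G.mem_neighborFinset k j).1 hj)).symm]
      have hrest : ∑ e ∈ G.edgeFinset with k ∉ e,
            Sym2.lift ⟨fun j j' => (y j : ℕ) * (y j' : ℕ), fun _ _ => Nat.mul_comm _ _⟩ e =
          ∑ e ∈ G.edgeFinset with k ∉ e,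
            Sym2.lift ⟨fun j j' => (x j : ℕ) * (x j' : ℕ), fun _ _ => Nat.mul_comm _ _⟩ e := by
        refine Finset.sum_congr rfl fun e he => ?_
        have hke := (Finset.mem_filter.1 he).2
        induction e with
        | h a b =>
          simp only [Sym2.mem_iff, not_or] at hke
          simp only [Sym2.lift_mk]
          rw [h a (Ne.symm hke.1), h b (Ne.symm hke.2)]
      have hprod : ∏ j ∈ Finset.univ.erase k,
          (if j = k then pY else if j ∈ G.neighborFinset k then pZ else 1) (x j) (y j) =
          (-1 : ℂ) ^ ∑ j ∈ G.neighborFinset k, (x j : ℕ) := by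
        rw [← Finset.prod_pow_eq_pow_sum]
        symm
        refine Finset.prod_subset_one_on_sdiff ?_ ?_ ?_
        · intro j hj
          exact Finset.mem_erase.2
            ⟨(G.ne_of_adj ((G.mem_neighborFinset k j).1 hj)).symm, Finset.mem_univ j⟩
        · intro j hj
          obtain ⟨hj, hnj⟩ := Finset.mem_sdiff.1 hj
          have hjk := Finset.ne_of_mem_erase hj
          rw [if_neg hjk, if_neg hnj, h j hjk, Matrix.one_apply_eq]
        · intro j hj
          have hjk := (G.ne_of_adj ((G.mem_neighborFinset k j).1 hj)).symm
          rw [if_neg hjk, if_pos hj, h j hjk, pZ_apply_self]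
      rw [hprod, sum_edges_eq G k x, sum_edges_eq G k y, hnbr, hrest, mul_right_comm, ← pow_add,
        mul_comm]
      congr 1
      generalize ∑ j ∈ G.neighborFinset k, (x j : ℕ) = n
      generalize (∑ e ∈ G.edgeFinset with k ∉ e,
        Sym2.lift ⟨fun j j' => (x j : ℕ) * (x j' : ℕ), fun _ _ => Nat.mul_comm _ _⟩ e) = r
      rw [show (x k : ℕ) * n + r + ((y k : ℕ) * n + r) =
          ((x k : ℕ) + (y k : ℕ)) * n + 2 * r by ring,
        hsum, one_mul, pow_add, pow_mul, neg_one_sq, one_pow, mul_one]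
  · push Not at h
    obtain ⟨j, hjk, hxy⟩ := h
    rw [mul_zero, zero_mul,
      Finset.prod_eq_zero (Finset.mem_erase.2 ⟨hjk, Finset.mem_univ j⟩), mul_zero]
    rw [if_neg hjk]
    split_ifs
    · generalize x j = a at *
      generalize y j = b at *
      fin_cases a <;> fin_cases b <;> simp_all [pZ]
    · exact Matrix.one_apply_ne hxy

end

end Qubits

/-- For the HEA block
V = CZ_E · ∏_j exp(-i·φ_j·Z_j/2) · ∏_j exp(-i·ϑ·X_j/2), the conjugated observable satisfies
V† · Y₁ · V = (cos(φ₁)·(cos(ϑ)·Y₁ − sin(ϑ)·Z₁) + sin(φ₁)·X₁) ·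
∏_{j ∈ N(1)} (cos(ϑ)·Z_j + sin(ϑ)·Y_j), where qubit 1 is the first qubit. -/
theorem stmt_14 {N : ℕ} (hN : 0 < N) (G : SimpleGraph (Fin N)) [DecidableRel G.Adj]
    (ϑ : ℝ) (φ : Fin N → ℝ)
    (V : QOp N)
    (hV : V = czLayer G *
      prodOver Finset.univ (fun j => exp ((-Complex.I * (φ j : ℂ) / 2) • onQubit pZ j)) *
      prodOver Finset.univ (fun j => exp ((-Complex.I * (ϑ : ℂ) / 2) • onQubit pX j))) :
    Vᴴ * onQubit pY ⟨0, hN⟩ * V =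
      ((Real.cos (φ ⟨0, hN⟩) : ℂ) •
          ((Real.cos ϑ : ℂ) • onQubit pY ⟨0, hN⟩ - (Real.sin ϑ : ℂ) • onQubit pZ ⟨0, hN⟩) +
        (Real.sin (φ ⟨0, hN⟩) : ℂ) • onQubit pX ⟨0, hN⟩) *
      prodOver (G.neighborFinset ⟨0, hN⟩)
        (fun j => (Real.cos ϑ : ℂ) • onQubit pZ j + (Real.sin ϑ : ℂ) • onQubit pY j) := by
  subst hV
  have hX : prodOver Finset.univ
      (fun j : Fin N => exp ((-Complex.I * (ϑ : ℂ) / 2) • onQubit pX j)) =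
      tensorOp (fun _ => rot pX ϑ) := by
    simp only [exp_onQubit pX pX_mul_self, prodOver_onQubit (fun _ => rot pX ϑ),
      Finset.mem_univ, if_true]
  have hZ : prodOver Finset.univ
      (fun j : Fin N => exp ((-Complex.I * (φ j : ℂ) / 2) • onQubit pZ j)) =
      tensorOp (fun j => rot pZ (φ j)) := by
    simp only [exp_onQubit pZ pZ_mul_self, prodOver_onQubit, Finset.mem_univ, if_true]
  rw [hX, hZ, Matrix.conjTranspose_mul, Matrix.conjTranspose_mul]
  generalize (⟨0, hN⟩ : Fin N) = k
  rw [show ∀ A B C Y A' B' C' : QOp N, A * (B * C) * Y * (C' * B' * A') =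
      A * (B * (C * Y * C') * B') * A' from fun _ _ _ _ _ _ _ => by simp only [mul_assoc],
    czLayer_conj_pY]
  simp only [tensorOp_conjTranspose, tensorOp_mul, ← onQubit_smul, ← onQubit_sub, ← onQubit_add]
  rw [prodOver_onQubit (fun _ => _), onQubit_eq_tensorOp, tensorOp_mul]
  congr 1
  funext j
  by_cases hj : j = k
  · subst hj
    simp only [if_true, SimpleGraph.mem_neighborFinset, SimpleGraph.irrefl, if_false, mul_one]
    rw [rotZ_conj_pY, mul_add, add_mul, mul_smul_comm, smul_mul_assoc, rotX_conj_pY,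
      mul_smul_comm, smul_mul_assoc, rot_conj_of_commute pX_isHermitian pX_mul_self rfl]
  · rw [if_neg hj, if_neg hj, one_mul]
    split_ifs
    · rw [rot_conj_of_commute pZ_isHermitian pZ_mul_self rfl, rotX_conj_pZ]
    · rw [rot_conj_of_commute pZ_isHermitian pZ_mul_self (by simp),
        rot_conj_of_commute pX_isHermitian pX_mul_self (by simp)]
end

section
/- For every 4×4 diagonal unitary complex matrix D, there exist real numbers a, b, c, d such that D = exp(i·(a·(Id₂⊗Id₂) + b·(Z⊗Id₂) + c·(Id₂⊗Z) + d·(Z⊗Z))), where Z = !![1,0;0,-1], Id₂ is the 2×2 identity matrix, ⊗ is the Kronecker product, and exp is the matrix exponential. -/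
open Matrix NormedSpace
open scoped Kronecker

noncomputable section

/-- Pauli Z. -/
def pZ : Matrix (Fin 2) (Fin 2) ℂ := !![1, 0; 0, -1]

/-- The diagonal entries of a diagonal unitary matrix have absolute value one. -/
theorem Matrix.IsDiag.norm_apply_self_of_mem_unitaryGroup {n : Type*} [Fintype n] [DecidableEq n]
    {D : Matrix n n ℂ} (hdiag : D.IsDiag) (hunit : D ∈ Matrix.unitaryGroup n ℂ) (i : n) :
    ‖D i i‖ = 1 := by
  have h := congrFun (congrFun (Matrix.mem_unitaryGroup_iff.mp hunit) i) i
  rw [Matrix.mul_apply, Finset.sum_eq_single i] at h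
  · simp only [Matrix.star_apply, RCLike.star_def, Complex.mul_conj, Complex.normSq_eq_norm_sq,
      Matrix.one_apply_eq] at h
    have h' : ‖D i i‖ ^ 2 = 1 := by exact_mod_cast h
    exact (pow_eq_one_iff_of_nonneg (norm_nonneg _) two_ne_zero).mp h'
  · intro j _ hj
    rw [hdiag hj.symm, zero_mul]
  · simp

/-- A diagonal unitary matrix is the exponential of `i` times the diagonal matrix of the
arguments of its diagonal entries. -/
theorem Matrix.IsDiag.eq_exp_diagonal_arg {n : Type*} [Fintype n] [DecidableEq n]
    {D : Matrix n n ℂ} (hdiag : D.IsDiag) (hunit : D ∈ Matrix.unitaryGroup n ℂ) :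
    D = exp (Complex.I • Matrix.diagonal fun i => ((D i i).arg : ℂ)) := by
  rw [← Matrix.diagonal_smul, Matrix.exp_diagonal]
  conv_lhs => rw [← hdiag.diagonal_diag]
  congr 1
  funext i
  have h := Complex.norm_mul_exp_arg_mul_I (D i i)
  rw [hdiag.norm_apply_self_of_mem_unitaryGroup hunit, Complex.ofReal_one, one_mul] at h
  rw [Pi.coe_exp, ← Complex.exp_eq_exp_ℂ]
  simp only [Pi.smul_apply, smul_eq_mul, Matrix.diag_apply]
  rw [mul_comm, h]

/-- Every 4×4 diagonal unitary matrix `D` (indexed by two qubits, i.e. by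
`Fin 2 × Fin 2`) can be written as
`D = exp(i·(a·(Id₂⊗Id₂) + b·(Z⊗Id₂) + c·(Id₂⊗Z) + d·(Z⊗Z)))` for some reals `a, b, c, d`. -/
theorem stmt_17 (D : Matrix (Fin 2 × Fin 2) (Fin 2 × Fin 2) ℂ)
    (hdiag : D.IsDiag) (hunit : D ∈ Matrix.unitaryGroup (Fin 2 × Fin 2) ℂ) :
    ∃ a b c d : ℝ,
      D = exp (Complex.I •
        ((a : ℂ) • ((1 : Matrix (Fin 2) (Fin 2) ℂ) ⊗ₖ (1 : Matrix (Fin 2) (Fin 2) ℂ)) +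
         (b : ℂ) • (pZ ⊗ₖ (1 : Matrix (Fin 2) (Fin 2) ℂ)) +
         (c : ℂ) • ((1 : Matrix (Fin 2) (Fin 2) ℂ) ⊗ₖ pZ) +
         (d : ℂ) • (pZ ⊗ₖ pZ))) := by
  set p := (D (0, 0) (0, 0)).arg with hp
  set q := (D (0, 1) (0, 1)).arg with hq
  set r := (D (1, 0) (1, 0)).arg with hr
  set s := (D (1, 1) (1, 1)).arg with hs
  refine ⟨(p + q + r + s) / 4, (p + q - r - s) / 4, (p - q + r - s) / 4, (p - q - r + s) / 4, ?_⟩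
  refine (hdiag.eq_exp_diagonal_arg hunit).trans ?_
  congr 2
  ext ⟨i, j⟩ ⟨k, l⟩
  fin_cases i <;> fin_cases j <;> fin_cases k <;> fin_cases l <;>
    simp [pZ, ← hp, ← hq, ← hr, ← hs] <;> ring

end
end

section
/- Fix N ≥ 1 qubits and let E' be any unitary matrix on the last N−1 qubits, so that the encoding unitary E = Id₂ ⊗ E' acts trivially on qubit 1. Let |0^N⟩ denote the all-zeros computational basis state. Then the function θ ↦ ⟨0^N| E† · exp(i·θ·X_1/2) · ((Id + Y_1)/2) · exp(-i·θ·X_1/2) · E |0^N⟩ is differentiable at θ = 0 with derivative equal to −1/2. -/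
open Matrix NormedSpace
open scoped Kronecker

noncomputable section

/-- Pauli X. -/
def pX : Matrix (Fin 2) (Fin 2) ℂ := !![0, 1; 1, 0]

/-- Pauli Y. -/
def pY : Matrix (Fin 2) (Fin 2) ℂ := !![0, -Complex.I; Complex.I, 0]

section ConjugationDerivative

open scoped Matrix.Norms.Operator

/-- The function `θ ↦ L exp(aθX/2) M exp(bθX/2) R` has derivative
`L (a/2 XM + b/2 MX) R` at `0`, here paired with fixed vectors `u` and `v`. -/
lemma hasDerivAt_dotProduct_exp_mul_exp {n : Type*} [Fintype n] [DecidableEq n]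
    (L X M R : Matrix n n ℂ) (a b : ℂ) (u v : n → ℂ) :
    HasDerivAt
      (fun θ : ℝ => u ⬝ᵥ ((L * exp ((a * (θ : ℂ) / 2) • X) * M *
        exp ((b * (θ : ℂ) / 2) • X) * R) *ᵥ v))
      (u ⬝ᵥ ((L * ((a / 2) • (X * M) + (b / 2) • (M * X)) * R) *ᵥ v)) 0 := by
  have hexp (c : ℂ) :
      HasDerivAt (fun θ : ℝ => exp ((c * (θ : ℂ) / 2) • X)) ((c / 2) • X) 0 := by
    have h := hasDerivAt_exp_smul_const (𝕂 := ℝ) ((c / 2) • X) (0 : ℝ)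
    simp only [zero_smul, exp_zero, one_mul] at h
    refine h.congr_of_eventuallyEq (Filter.Eventually.of_forall fun θ => ?_)
    simp only [← Complex.coe_smul θ, smul_smul]
    congr 2
    ring
  have hprod := ((((hexp a).const_mul L).mul_const M).mul (hexp b)).mul_const R
  have hpair : Continuous fun A : Matrix n n ℂ => u ⬝ᵥ (A *ᵥ v) := by fun_prop
  let φ : Matrix n n ℂ →L[ℝ] ℂ :=
    { toFun := fun A => u ⬝ᵥ (A *ᵥ v)
      map_add' := fun A B => by rw [add_mulVec, dotProduct_add]
      map_smul' := fun c A => by rw [smul_mulVec, dotProduct_smul]; rfl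
      cont := hpair }
  refine (φ.hasFDerivAt.comp_hasDerivAt (0 : ℝ) hprod).congr_deriv ?_
  change u ⬝ᵥ (_ *ᵥ v) = _
  congr 2
  simp [mul_add, mul_assoc]

end ConjugationDerivative

/-- The commutator identity `(i/2)[X, (1 + Y)/2] = -Z/2`. -/
lemma pauli_commutator :
    (Complex.I / 2) • (pX * ((2 : ℂ)⁻¹ • (1 + pY))) +
      (-Complex.I / 2) • (((2 : ℂ)⁻¹ • (1 + pY)) * pX) = !![-(1 / 2), 0; 0, 1 / 2] := by
  rw [pX, pY, one_fin_two]
  ext i j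
  fin_cases i <;> fin_cases j <;> simp <;> ring_nf <;> simp <;> norm_num

/-- Fix `N ≥ 1` qubits; the N-qubit space is split as qubit 1 times the last
`N−1` qubits, i.e. indexed by `Fin 2 × (Fin (N-1) → Fin 2)`. For any unitary `E'` on the last
`N−1` qubits, the encoding unitary `E = Id₂ ⊗ E'` acts trivially on qubit 1, and for the
all-zeros state `|0^N⟩` the function
`θ ↦ ⟨0^N| E† · exp(i·θ·X₁/2) · ((Id + Y₁)/2) · exp(-i·θ·X₁/2) · E |0^N⟩`
is differentiable at `θ = 0` with derivative `−1/2`. -/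
theorem stmt_19 (N : ℕ) (hN : 1 ≤ N)
    (E' : Matrix (Fin (N - 1) → Fin 2) (Fin (N - 1) → Fin 2) ℂ)
    (hE' : E' ∈ Matrix.unitaryGroup (Fin (N - 1) → Fin 2) ℂ)
    (Enc : Matrix (Fin 2 × (Fin (N - 1) → Fin 2)) (Fin 2 × (Fin (N - 1) → Fin 2)) ℂ)
    (hEnc : Enc = (1 : Matrix (Fin 2) (Fin 2) ℂ) ⊗ₖ E')
    (X₁ Y₁ : Matrix (Fin 2 × (Fin (N - 1) → Fin 2)) (Fin 2 × (Fin (N - 1) → Fin 2)) ℂ)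
    (hX₁ : X₁ = pX ⊗ₖ (1 : Matrix (Fin (N - 1) → Fin 2) (Fin (N - 1) → Fin 2) ℂ))
    (hY₁ : Y₁ = pY ⊗ₖ (1 : Matrix (Fin (N - 1) → Fin 2) (Fin (N - 1) → Fin 2) ℂ))
    (ψ₀ : Fin 2 × (Fin (N - 1) → Fin 2) → ℂ)
    (hψ₀ : ψ₀ = fun p => if p = ((0 : Fin 2), fun _ => (0 : Fin 2)) then 1 else 0) :
    HasDerivAt
      (fun θ : ℝ => star ψ₀ ⬝ᵥ
        ((Encᴴ * exp ((Complex.I * (θ : ℂ) / 2) • X₁) *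
          ((2 : ℂ)⁻¹ • (1 + Y₁)) *
          exp ((-Complex.I * (θ : ℂ) / 2) • X₁) * Enc) *ᵥ ψ₀))
      (-(1 / 2) : ℂ) 0 := by
  have hid : (1 : Matrix (Fin 2 × (Fin (N - 1) → Fin 2)) (Fin 2 × (Fin (N - 1) → Fin 2)) ℂ) =
      1 ⊗ₖ 1 := one_kronecker_one.symm
  have hunit : E'ᴴ * E' = 1 := mem_unitaryGroup_iff'.mp hE'
  have hψ : ψ₀ = Pi.single ((0 : Fin 2), fun _ => (0 : Fin 2)) 1 := by
    rw [hψ₀]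
    ext p
    rw [Pi.single_apply]
  refine (hasDerivAt_dotProduct_exp_mul_exp _ _ _ _ _ _ _ _).congr_deriv ?_
  have hobs : Encᴴ * ((Complex.I / 2) • (X₁ * ((2 : ℂ)⁻¹ • (1 + Y₁))) +
      (-Complex.I / 2) • (((2 : ℂ)⁻¹ • (1 + Y₁)) * X₁)) * Enc =
      !![-(1 / 2), 0; 0, 1 / 2] ⊗ₖ 1 := by
    rw [hEnc, hX₁, hY₁, hid, ← add_kronecker, ← smul_kronecker, ← mul_kronecker_mul,
      ← mul_kronecker_mul, ← smul_kronecker, ← smul_kronecker, mul_one, ← add_kronecker,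
      pauli_commutator, conjTranspose_kronecker, ← mul_kronecker_mul, ← mul_kronecker_mul,
      conjTranspose_one, one_mul, mul_one, mul_one, hunit]
  rw [hobs, hψ]
  simp [Pi.star_single]

end
end
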